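/- Let μ₀ be a probability measure on [−1,1], Θ = [−1,1]^{ℤ²} with the product σ-algebra and product probability measure ℙ = ⊗_{ℤ²} μ₀, 𝔼 the expectation with respect to ℙ, and for γ ∈ ℤ² let T(γ) : Θ → Θ be the shift (T(γ)ω)_{γ'} = ω_{γ'+γ}. Let (h_ω)_{ω∈Θ} be a family of kernels h_ω : ℝ² × ℝ² → ℂ, jointly measurable in (ω,x,y), jointly continuous in (x,y), with |h_ω(x,y)| ≤ C e^{−δ‖x−y‖} uniformly in ω for some C, δ > 0. Assume the magnetic covariance relation: for every γ ∈ ℤ² there is a measurable function θ_γ : ℝ² → ℝ such that h_{T(γ)ω}(x,y) = e^{i(θ_γ(x) − θ_γ(y))} h_ω(x−γ, y−γ) for all x, y ∈ ℝ² and ω ∈ Θ. Define iterated kernel compositions h_ω^{(1)} = h_ω and h_ω^{(M+1)}(x,y) = ∫_{ℝ²} h_ω(x,z) h_ω^{(M)}(z,y) dz. Then for every M ≥ 1 and i ∈ {1,2}, 𝔼( ∫_{[0,1]²} dx ∫_{ℝ²} dy h_ω(x,y) (y_i − x_i) h_ω^{(M)}(y,x) ) = 0. -/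

import Mathlib

open MeasureTheory Filter Set

noncomputable section

/-- The disorder configuration space `Θ = [−1,1]^{ℤ²}`, with the product σ-algebra. -/
abbrev DisorderSpace : Type := (ℤ × ℤ) → Set.Icc (-1 : ℝ) 1

/-- The shift `(T(γ)ω)_{γ'} = ω_{γ'+γ}`. -/
def disorderShift (γ : ℤ × ℤ) (ω : DisorderSpace) : DisorderSpace :=
  fun γ' => ω (γ' + γ)

/-- The Euclidean norm on `ℝ²` realized as `ℝ × ℝ`. -/
def eNorm2 (x : ℝ × ℝ) : ℝ := Real.sqrt (x.1 ^ 2 + x.2 ^ 2)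

/-- Embedding of the lattice `ℤ²` into `ℝ²`. -/
def latR2 (γ : ℤ × ℤ) : ℝ × ℝ := ((γ.1 : ℝ), (γ.2 : ℝ))

/-- Iterated kernel compositions: `iterKernel h M = h^{(M+1)}`, i.e.
`iterKernel h 0 = h = h^{(1)}` and
`h^{(M+1)}(x,y) = ∫ h(x,z) h^{(M)}(z,y) dz`. -/
def iterKernel (h : (ℝ × ℝ) → (ℝ × ℝ) → ℂ) : ℕ → (ℝ × ℝ) → (ℝ × ℝ) → ℂ
  | 0 => h
  | M + 1 => fun x y => ∫ z : ℝ × ℝ, h x z * iterKernel h M z y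

/-- Exponential profile. -/
def expProf (d : ℝ) (x : ℝ × ℝ) : ℝ := Real.exp (-d * ‖x‖)

lemma expProf_nonneg (d : ℝ) (x : ℝ × ℝ) : 0 ≤ expProf d x := (Real.exp_pos _).le

lemma expProf_neg (d : ℝ) (x : ℝ × ℝ) : expProf d (-x) = expProf d x := by simp [expProf]

lemma expProf_comm (d : ℝ) (x y : ℝ × ℝ) : expProf d (x - y) = expProf d (y - x) := by
  simp [expProf, norm_sub_rev]

lemma expProf_anti {d d' : ℝ} (hd : d ≤ d') (x : ℝ × ℝ) : expProf d' x ≤ expProf d x := by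
  unfold expProf
  apply Real.exp_le_exp.2
  nlinarith [norm_nonneg x]

lemma expProf_le_one {d : ℝ} (hd : 0 < d) (x : ℝ × ℝ) : expProf d x ≤ 1 := by
  unfold expProf
  apply Real.exp_le_one_iff.2
  nlinarith [norm_nonneg x]

lemma measurable_expProf (d : ℝ) : Measurable (expProf d) := by
  unfold expProf; fun_prop

lemma expProf_split (d : ℝ) (hd : 0 < d) (x z y : ℝ × ℝ) :
    expProf d (x - z) * expProf d (z - y) ≤ expProf (d/2) (x - y) * expProf (d/2) (x - z) := by
  unfold expProf
  rw [← Real.exp_add, ← Real.exp_add]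
  apply Real.exp_le_exp.2
  have h1 : ‖x - y‖ ≤ ‖x - z‖ + ‖z - y‖ := norm_sub_le_norm_sub_add_norm_sub x z y
  nlinarith [norm_nonneg (z - y)]

lemma integrable_expProf {d : ℝ} (hd : 0 < d) : Integrable (expProf d) := by
  have h1 : Integrable (fun x : ℝ × ℝ => (1 + ‖x‖) ^ (-(3:ℝ))) := by
    apply integrable_one_add_norm
    simp
    norm_num
  refine (h1.const_mul ((1 + 3/d)^3)).mono' (measurable_expProf d).aestronglyMeasurable
    (Eventually.of_forall fun x => ?_)
  rw [Real.norm_of_nonneg (expProf_nonneg d x)]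
  have hu := norm_nonneg x
  set u := ‖x‖ with hu'
  have h2 : 1 + u ≤ (1 + 3/d) * Real.exp (d*u/3) := by
    have h3 : d*u/3 + 1 ≤ Real.exp (d*u/3) := Real.add_one_le_exp _
    have h4 : 1 + u ≤ (1 + 3/d) * (d*u/3 + 1) := by
      have : (1 + 3/d) * (d*u/3 + 1) = 1 + u + (d*u/3 + 3/d) := by field_simp; ring
      rw [this]
      have : 0 ≤ d*u/3 + 3/d := by positivity
      linarith
    exact h4.trans (by gcongr)
  have h5 : (1 + u)^3 ≤ (1 + 3/d)^3 * Real.exp (d*u) := by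
    calc (1+u)^3 ≤ ((1 + 3/d) * Real.exp (d*u/3))^3 := by gcongr
      _ = _ := by rw [mul_pow, ← Real.exp_nat_mul]; congr 2; push_cast; ring
  have h6 : (1 + u) ^ (-(3:ℝ)) = ((1+u)^3)⁻¹ := by
    rw [Real.rpow_neg (by positivity)]; norm_cast
  rw [h6, expProf, neg_mul, Real.exp_neg, ← hu', ← div_eq_mul_inv, le_div_iff₀ (by positivity),
    inv_mul_le_iff₀ (Real.exp_pos _)]
  linarith

/-- A kernel family. -/
abbrev Ker := DisorderSpace → (ℝ × ℝ) → (ℝ × ℝ) → ℂ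

/-- composition of kernels -/
def kconv (A B : Ker) : Ker := fun ω x y => ∫ z : ℝ × ℝ, A ω x z * B ω z y

/-- the commutator with the position -/
def kder (coord : (ℝ × ℝ) → ℝ) (A : Ker) : Ker :=
  fun ω x y => A ω x y * ((coord y - coord x) : ℂ)

/-- Well-behaved kernels. -/
structure GoodKer (θ : ℤ × ℤ → (ℝ × ℝ) → ℝ) (A : Ker) : Prop where
  meas : Measurable (fun p : DisorderSpace × (ℝ × ℝ) × (ℝ × ℝ) => A p.1 p.2.1 p.2.2)
  bound : ∃ C d : ℝ, 0 ≤ C ∧ 0 < d ∧ ∀ ω x y, ‖A ω x y‖ ≤ C * expProf d (x - y)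
  cov : ∀ γ ω x y, A (disorderShift γ ω) x y
          = Complex.exp (Complex.I * (θ γ x - θ γ y)) * A ω (x - latR2 γ) (y - latR2 γ)

lemma GoodKer.meas_comp {θ : ℤ × ℤ → (ℝ × ℝ) → ℝ} {A : Ker} (hA : GoodKer θ A)
    {α : Type*} [MeasurableSpace α] {f : α → DisorderSpace} {g k : α → ℝ × ℝ}
    (hf : Measurable f) (hg : Measurable g) (hk : Measurable k) :
    Measurable (fun a => A (f a) (g a) (k a)) :=
  hA.meas.comp (hf.prodMk (hg.prodMk hk))

lemma good_bound2 {θ : ℤ × ℤ → (ℝ × ℝ) → ℝ} {A B : Ker} (hA : GoodKer θ A) (hB : GoodKer θ B) :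
    ∃ C d : ℝ, 0 ≤ C ∧ 0 < d ∧ (∀ ω x y, ‖A ω x y‖ ≤ C * expProf d (x - y)) ∧
      (∀ ω x y, ‖B ω x y‖ ≤ C * expProf d (x - y)) := by
  obtain ⟨C, d, hC, hd, h⟩ := hA.bound
  obtain ⟨C', d', hC', hd', h'⟩ := hB.bound
  refine ⟨max C C', min d d', le_max_of_le_left hC, lt_min hd hd', fun ω x y => ?_, fun ω x y => ?_⟩
  · exact (h ω x y).trans (mul_le_mul (le_max_left _ _) (expProf_anti (min_le_left _ _) _)
      (expProf_nonneg _ _) (le_max_of_le_left hC))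
  · exact (h' ω x y).trans (mul_le_mul (le_max_right _ _) (expProf_anti (min_le_right _ _) _)
      (expProf_nonneg _ _) (le_max_of_le_left hC))

lemma good_int {θ : ℤ × ℤ → (ℝ × ℝ) → ℝ} {A B : Ker} (hA : GoodKer θ A) (hB : GoodKer θ B)
    (ω : DisorderSpace) (x y : ℝ × ℝ) : Integrable (fun z => A ω x z * B ω z y) := by
  obtain ⟨C, d, hC, hd, h, h'⟩ := good_bound2 hA hB
  refine (((integrable_expProf hd).comp_sub_left x).const_mul (C * C)).mono'
    ((hA.meas_comp measurable_const measurable_const measurable_id).mul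
      (hB.meas_comp measurable_const measurable_id measurable_const)).aestronglyMeasurable
    (Eventually.of_forall fun z => ?_)
  rw [norm_mul]
  calc _ ≤ (C * expProf d (x - z)) * (C * 1) := by
        apply mul_le_mul (h ω x z) ((h' ω z y).trans ?_) (norm_nonneg _)
          (mul_nonneg hC (expProf_nonneg _ _))
        gcongr
        exact expProf_le_one hd _
    _ = _ := by ring

lemma good_conv {θ : ℤ × ℤ → (ℝ × ℝ) → ℝ} {A B : Ker} (hA : GoodKer θ A) (hB : GoodKer θ B) :
    GoodKer θ (kconv A B) where
  meas := by
    have h1 : Measurable (fun q : (DisorderSpace × (ℝ × ℝ) × (ℝ × ℝ)) × (ℝ × ℝ) =>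
        A q.1.1 q.1.2.1 q.2 * B q.1.1 q.2 q.1.2.2) :=
      (hA.meas_comp (by fun_prop) (by fun_prop) (by fun_prop)).mul
        (hB.meas_comp (by fun_prop) (by fun_prop) (by fun_prop))
    exact (h1.stronglyMeasurable.integral_prod_right (ν := volume)).measurable
  bound := by
    obtain ⟨C, d, hC, hd, h, h'⟩ := good_bound2 hA hB
    have hd2 : 0 < d / 2 := by linarith
    refine ⟨C * C * ∫ z, expProf (d/2) z, d/2,
      mul_nonneg (mul_nonneg hC hC) (integral_nonneg (expProf_nonneg _)), hd2, fun ω x y => ?_⟩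
    unfold kconv
    have hi := ((integrable_expProf hd2).comp_sub_left x).const_mul (C * C * expProf (d/2) (x - y))
    refine (norm_integral_le_of_norm_le hi (Eventually.of_forall fun z => ?_)).trans ?_
    · rw [norm_mul]
      calc _ ≤ (C * expProf d (x - z)) * (C * expProf d (z - y)) := by
            apply mul_le_mul (h ω x z) (h' ω z y) (norm_nonneg _)
              (mul_nonneg hC (expProf_nonneg _ _))
        _ = C * C * (expProf d (x - z) * expProf d (z - y)) := by ring
        _ ≤ C * C * (expProf (d/2) (x - y) * expProf (d/2) (x - z)) := by
            exact mul_le_mul_of_nonneg_left (expProf_split d hd x z y) (mul_nonneg hC hC)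
        _ = _ := by ring
    · rw [integral_const_mul, integral_sub_left_eq_self (expProf (d/2)) volume x]
      apply le_of_eq; ring
  cov := by
    intro γ ω x y
    unfold kconv
    rw [← integral_const_mul,
      ← integral_sub_right_eq_self (fun z => Complex.exp (Complex.I * (θ γ x - θ γ y)) *
        (A ω (x - latR2 γ) z * B ω z (y - latR2 γ))) (latR2 γ)]
    congr 1
    funext z
    rw [hA.cov, hB.cov]
    have : Complex.exp (Complex.I * (θ γ x - θ γ y)) = Complex.exp (Complex.I * (θ γ x - θ γ z))
        * Complex.exp (Complex.I * (θ γ z - θ γ y)) := by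
      rw [← Complex.exp_add]; congr 1; ring
    rw [this]; ring

/-- coordinate functions -/
def IsCoord (coord : (ℝ × ℝ) → ℝ) : Prop := coord = Prod.fst ∨ coord = Prod.snd

lemma good_der {θ : ℤ × ℤ → (ℝ × ℝ) → ℝ} {A : Ker} (hA : GoodKer θ A)
    {coord : (ℝ × ℝ) → ℝ} (hc : IsCoord coord) : GoodKer θ (kder coord A) where
  meas := by
    have hm : Measurable coord := by
      rcases hc with rfl | rfl
      · exact measurable_fst
      · exact measurable_snd
    unfold kder
    exact hA.meas.mul (by fun_prop)
  bound := by
    obtain ⟨C, d, hC, hd, h⟩ := hA.bound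
    have hd2 : 0 < d / 2 := by linarith
    refine ⟨C * (2/d), d/2, by positivity, hd2, fun ω x y => ?_⟩
    have h1 : ‖((coord y - coord x : ℝ) : ℂ)‖ ≤ ‖x - y‖ := by
      rw [Complex.norm_real, norm_sub_rev x y]
      rcases hc with rfl | rfl
      · exact norm_fst_le (y - x)
      · exact norm_snd_le (y - x)
    unfold kder
    rw [← Complex.ofReal_sub, norm_mul]
    have h2 : expProf d (x - y) * ‖x - y‖ ≤ (2/d) * expProf (d/2) (x - y) := by
      unfold expProf
      set u := ‖x - y‖
      have h3 : u ≤ (2/d) * Real.exp (d/2 * u) := by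
        have := Real.add_one_le_exp (d/2*u)
        rw [div_mul_eq_mul_div, le_div_iff₀ hd]
        linarith
      have h4 : Real.exp (-d * u) * Real.exp (d/2*u) = Real.exp (-(d/2) * u) := by
        rw [← Real.exp_add]; congr 1; ring
      calc _ ≤ Real.exp (-d * u) * ((2/d) * Real.exp (d/2 * u)) := by gcongr
        _ = (2/d) * (Real.exp (-d * u) * Real.exp (d/2*u)) := by ring
        _ = _ := by rw [h4]
    calc _ ≤ (C * expProf d (x - y)) * ‖x - y‖ :=
          mul_le_mul (h ω x y) h1 (norm_nonneg _) (mul_nonneg hC (expProf_nonneg _ _))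
      _ = C * (expProf d (x - y) * ‖x - y‖) := by ring
      _ ≤ C * ((2/d) * expProf (d/2) (x - y)) := by gcongr
      _ = _ := by ring
  cov := by
    intro γ ω x y
    unfold kder
    rw [hA.cov]
    rcases hc with rfl | rfl <;> simp <;> ring

lemma kder_conv {θ : ℤ × ℤ → (ℝ × ℝ) → ℝ} {A B : Ker} (hA : GoodKer θ A) (hB : GoodKer θ B)
    {coord : (ℝ × ℝ) → ℝ} (hc : IsCoord coord) :
    kder coord (kconv A B) = kconv (kder coord A) B + kconv A (kder coord B) := by
  funext ω x y
  have h1 := good_int (good_der hA hc) hB ω x y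
  have h2 := good_int hA (good_der hB hc) ω x y
  simp only [Pi.add_apply]
  unfold kconv
  rw [← integral_add h1 h2]
  unfold kder
  rw [← integral_mul_const]
  congr 1
  funext z
  ring

lemma kconv_add_left {θ : ℤ × ℤ → (ℝ × ℝ) → ℝ} {A B D : Ker} (hA : GoodKer θ A)
    (hB : GoodKer θ B) (hD : GoodKer θ D) : kconv (A + B) D = kconv A D + kconv B D := by
  funext ω x y
  simp only [Pi.add_apply]
  unfold kconv
  rw [← integral_add (good_int hA hD ω x y) (good_int hB hD ω x y)]
  simp only [Pi.add_apply, add_mul]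

lemma integrable_pair {d : ℝ} (hd : 0 < d) (x : ℝ × ℝ) :
    Integrable (fun p : (ℝ × ℝ) × (ℝ × ℝ) => expProf d (x - p.1) * expProf d (p.1 - p.2))
      (volume.prod volume) := by
  have := (((integrable_expProf hd).comp_sub_left x).convolution_integrand
    (ContinuousLinearMap.mul ℝ ℝ) (integrable_expProf hd)).swap
  refine this.congr (Eventually.of_forall fun p => ?_)
  simp [expProf_comm d p.1 p.2]

lemma kconv_assoc {θ : ℤ × ℤ → (ℝ × ℝ) → ℝ} {A B D : Ker} (hA : GoodKer θ A)
    (hB : GoodKer θ B) (hD : GoodKer θ D) :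
    kconv (kconv A B) D = kconv A (kconv B D) := by
  funext ω x y
  unfold kconv
  simp_rw [← integral_mul_const, ← integral_const_mul]
  rw [integral_integral_swap]
  · simp_rw [mul_assoc]
  · obtain ⟨C, d, hC, hd, h, h'⟩ := good_bound2 hA hB
    obtain ⟨C', d', hC', hd', h''⟩ := hD.bound
    refine (((integrable_pair hd x).swap).const_mul (C * C * C')).mono' ?_
      (Eventually.of_forall fun p => ?_)
    · exact (((hA.meas_comp (by fun_prop) (by fun_prop) (by fun_prop)).mul
        (hB.meas_comp (by fun_prop) (by fun_prop) (by fun_prop))).mul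
        (hD.meas_comp (by fun_prop) (by fun_prop) (by fun_prop))).aestronglyMeasurable
    · simp only [Function.uncurry, norm_mul, Function.comp, Prod.swap]
      have h1 := h ω x p.2
      have h2 := h' ω p.2 p.1
      have h3 : ‖D ω p.1 y‖ ≤ C' * 1 :=
        (h'' ω p.1 y).trans (by gcongr; exact expProf_le_one hd' _)
      have e1 := expProf_nonneg d (x - p.2)
      have e2 := expProf_nonneg d (p.2 - p.1)
      calc _ ≤ ((C * expProf d (x - p.2)) * (C * expProf d (p.2 - p.1))) * (C' * 1) := by gcongr
        _ = _ := by ring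

/-- the unit cell -/
def ucell : Set (ℝ × ℝ) := Set.Icc (0:ℝ) 1 ×ˢ Set.Icc (0:ℝ) 1

/-- half-open unit cell -/
def hcell : Set (ℝ × ℝ) := Set.Ico (0:ℝ) 1 ×ˢ Set.Ico (0:ℝ) 1

lemma hcell_ae : hcell =ᵐ[volume] ucell := by
  unfold hcell ucell
  rw [Measure.volume_eq_prod]
  exact Measure.set_prod_ae_eq Ico_ae_eq_Icc Ico_ae_eq_Icc

lemma hcell_meas : MeasurableSet hcell := measurableSet_Ico.prod measurableSet_Ico

instance hcell_fin : IsFiniteMeasure (volume.restrict hcell) := by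
  constructor
  rw [Measure.restrict_apply_univ, measure_congr hcell_ae]
  exact (isCompact_Icc.prod isCompact_Icc).measure_lt_top

lemma cell_unique (x : ℝ × ℝ) : ∃! γ : ℤ × ℤ, latR2 γ + x ∈ hcell := by
  refine ⟨(-⌊x.1⌋, -⌊x.2⌋), ?_, ?_⟩
  · simp only [hcell, latR2, Set.mem_prod, Set.mem_Ico, Prod.fst_add, Prod.snd_add]
    push_cast
    have := Int.floor_le x.1
    have := Int.floor_le x.2
    have := Int.lt_floor_add_one x.1
    have := Int.lt_floor_add_one x.2
    refine ⟨⟨?_, ?_⟩, ?_, ?_⟩ <;> linarith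
  · rintro ⟨a, b⟩ hab
    simp only [hcell, latR2, Set.mem_prod, Set.mem_Ico, Prod.fst_add, Prod.snd_add] at hab
    obtain ⟨⟨h1, h2⟩, h3, h4⟩ := hab
    have e1 : ⌊x.1⌋ = -a := Int.floor_eq_iff.2 ⟨by push_cast; linarith, by push_cast; linarith⟩
    have e2 : ⌊x.2⌋ = -b := Int.floor_eq_iff.2 ⟨by push_cast; linarith, by push_cast; linarith⟩
    simp [e1, e2]

/-- diagonal embedding of the lattice -/
def diagHom : ℤ × ℤ →+ (ℝ × ℝ) × (ℝ × ℝ) where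
  toFun γ := (latR2 γ, latR2 γ)
  map_zero' := by simp [latR2]
  map_add' := by intro a b; simp [latR2]

lemma diagHom_apply (γ : ℤ × ℤ) : diagHom γ = (latR2 γ, latR2 γ) := rfl

instance diag_inv : VAddInvariantMeasure diagHom.range ((ℝ × ℝ) × (ℝ × ℝ)) volume := by
  constructor
  intro c s _
  rw [Measure.volume_eq_prod (ℝ × ℝ) (ℝ × ℝ)]
  exact measure_preimage_add ((volume : Measure (ℝ × ℝ)).prod (volume : Measure (ℝ × ℝ))) c.1 s

lemma latR2_inj : Function.Injective latR2 := by
  rintro ⟨a, b⟩ ⟨c, d⟩ h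
  simp only [latR2, Prod.mk.injEq, Int.cast_inj] at h
  simp [h]

instance diag_countable : Countable diagHom.range :=
  (Set.countable_range diagHom).to_subtype

lemma diag_exists {s : Set ((ℝ × ℝ) × (ℝ × ℝ))} (p : (ℝ × ℝ) × (ℝ × ℝ))
    (h : ∃! γ : ℤ × ℤ, diagHom γ + p ∈ s) : ∃! g : diagHom.range, g +ᵥ p ∈ s := by
  obtain ⟨γ, h1, h2⟩ := h
  refine ⟨⟨diagHom γ, ⟨γ, rfl⟩⟩, h1, ?_⟩
  rintro ⟨_, ⟨γ', rfl⟩⟩ h3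
  have := h2 γ' h3
  subst this
  rfl

lemma fund1 : IsAddFundamentalDomain diagHom.range (hcell ×ˢ (univ : Set (ℝ × ℝ)))
    (volume : Measure ((ℝ × ℝ) × (ℝ × ℝ))) := by
  refine IsAddFundamentalDomain.mk' (hcell_meas.prod MeasurableSet.univ).nullMeasurableSet
    fun p => diag_exists p ?_
  simpa [diagHom_apply] using cell_unique p.1

lemma fund2 : IsAddFundamentalDomain diagHom.range ((univ : Set (ℝ × ℝ)) ×ˢ hcell)
    (volume : Measure ((ℝ × ℝ) × (ℝ × ℝ))) := by
  refine IsAddFundamentalDomain.mk' (MeasurableSet.univ.prod hcell_meas).nullMeasurableSet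
    fun p => diag_exists p ?_
  simpa [diagHom_apply] using cell_unique p.2

/-- Unfolding: exchange of the roles of the two variables for a diagonally periodic function. -/
lemma cell_swap (G : (ℝ × ℝ) × (ℝ × ℝ) → ℂ)
    (hG : ∀ γ p, G (diagHom γ + p) = G p) :
    ∫ p in hcell ×ˢ (univ : Set (ℝ × ℝ)), G p = ∫ p in hcell ×ˢ (univ : Set (ℝ × ℝ)), G p.swap := by
  rw [fund1.setIntegral_eq fund2 (f := G)]
  · have hmp : MeasurePreserving (Prod.swap : (ℝ × ℝ) × (ℝ × ℝ) → _) volume volume :=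
      Measure.measurePreserving_swap
    rw [← hmp.setIntegral_preimage_emb MeasurableEquiv.prodComm.measurableEmbedding]
    congr 2
    ext p
    simp [and_comm]
  · rintro ⟨_, ⟨γ, rfl⟩⟩ p
    exact hG γ p

/-- trace per unit volume -/
def tpv (P : Measure DisorderSpace) (A : Ker) : ℂ := ∫ ω, (∫ x in ucell, A ω x x) ∂P

lemma shift_meas (γ : ℤ × ℤ) : Measurable (disorderShift γ) :=
  measurable_pi_lambda _ fun γ' => measurable_pi_apply _

lemma shift_mp (μ0 : Measure (Set.Icc (-1 : ℝ) 1)) [IsProbabilityMeasure μ0]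
    (P : Measure DisorderSpace)
    (hP : ∀ (s : Finset (ℤ × ℤ)) (A : (ℤ × ℤ) → Set (Set.Icc (-1 : ℝ) 1)),
      (∀ i ∈ s, MeasurableSet (A i)) →
        P {ω | ∀ i ∈ s, ω i ∈ A i} = ∏ i ∈ s, μ0 (A i)) (γ : ℤ × ℤ) :
    MeasurePreserving (disorderShift γ) P P := by
  refine ⟨shift_meas γ, ?_⟩
  have h1 : P = Measure.infinitePi (fun _ => μ0) := by
    apply Measure.eq_infinitePi
    intro s t ht
    exact hP s t fun i _ => ht i
  have h2 : P.map (disorderShift γ) = Measure.infinitePi (fun _ => μ0) := by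
    apply Measure.eq_infinitePi
    intro s t ht
    rw [Measure.map_apply (shift_meas γ)
      (MeasurableSet.pi s.countable_toSet fun i _ => ht i)]
    have := hP (s.map (addRightEmbedding γ)) (fun j => t (j - γ)) fun i _ => ht _
    rw [Finset.prod_map] at this
    have e : ∀ i : ℤ × ℤ, t (i + γ - γ) = t i := fun i => by rw [add_sub_cancel_right]
    refine Eq.trans ?_ (this.trans (Finset.prod_congr rfl fun i _ => congrArg μ0 (e i)))
    congr 1
    ext ω
    constructor
    · intro hω j hj
      obtain ⟨i, hi, rfl⟩ := Finset.mem_map.1 hj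
      have h3 : ω (i + γ) ∈ t i := hω i hi
      rw [← e i] at h3
      exact h3
    · intro hω i hi
      have h3 : ω (i + γ) ∈ t (i + γ - γ) := hω (i + γ) (Finset.mem_map.2 ⟨i, hi, rfl⟩)
      rw [e i] at h3
      exact h3
  rw [h2, ← h1]

section trace

variable {P : Measure DisorderSpace} [IsProbabilityMeasure P] {θ : ℤ × ℤ → (ℝ × ℝ) → ℝ}
  {A B : Ker}

lemma full_int (hA : GoodKer θ A) (hB : GoodKer θ B) :
    Integrable (fun q : DisorderSpace × ((ℝ × ℝ) × (ℝ × ℝ)) =>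
      A q.1 q.2.1 q.2.2 * B q.1 q.2.2 q.2.1)
      (P.prod ((volume.restrict hcell).prod volume)) := by
  obtain ⟨C, d, hC, hd, h, h'⟩ := good_bound2 hA hB
  have h0 : Integrable (fun _ : ℝ × ℝ => (1:ℝ)) (volume.restrict hcell) := integrable_const _
  have h1 : Integrable (fun p : (ℝ × ℝ) × (ℝ × ℝ) => expProf d (p.1 - p.2))
      ((volume.restrict hcell).prod volume) := by
    have := (h0.convolution_integrand (μ := volume)
      (ContinuousLinearMap.mul ℝ ℝ) (integrable_expProf hd)).swap
    refine this.congr (Eventually.of_forall fun p => ?_)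
    simp [expProf_comm d p.1 p.2]
  refine ((h1.comp_snd P).const_mul (C * C)).mono' ?_ (Eventually.of_forall fun q => ?_)
  · exact ((hA.meas_comp (by fun_prop) (by fun_prop) (by fun_prop)).mul
        (hB.meas_comp (by fun_prop) (by fun_prop) (by fun_prop))).aestronglyMeasurable
  · rw [norm_mul]
    have h3 : ‖B q.1 q.2.2 q.2.1‖ ≤ C * 1 :=
        (h' _ _ _).trans (by gcongr; exact expProf_le_one hd _)
    have e1 := expProf_nonneg d (q.2.1 - q.2.2)
    have h1 := h q.1 q.2.1 q.2.2
    calc _ ≤ (C * expProf d (q.2.1 - q.2.2)) * (C * 1) := by gcongr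
      _ = _ := by ring

lemma tpv_conv (hA : GoodKer θ A) (hB : GoodKer θ B) :
    tpv P (kconv A B) = ∫ p in hcell ×ˢ (univ : Set (ℝ × ℝ)),
      ∫ ω, A ω p.1 p.2 * B ω p.2 p.1 ∂P := by
  have hf := full_int (P := P) hA hB
  have e : (volume : Measure ((ℝ × ℝ) × (ℝ × ℝ))).restrict (hcell ×ˢ (univ : Set (ℝ × ℝ)))
      = (volume.restrict hcell).prod volume := by
    rw [Measure.volume_eq_prod (ℝ × ℝ) (ℝ × ℝ), ← Measure.prod_restrict, Measure.restrict_univ]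
  rw [e, ← integral_integral_swap (f := fun ω (p : (ℝ × ℝ) × (ℝ × ℝ)) =>
    A ω p.1 p.2 * B ω p.2 p.1) hf]
  unfold tpv
  refine integral_congr_ae ?_
  filter_upwards [hf.prod_right_ae] with ω hω
  rw [← setIntegral_congr_set hcell_ae, integral_prod _ hω]
  rfl

lemma tpv_conv_int (hA : GoodKer θ A) (hB : GoodKer θ B) :
    Integrable (fun ω => ∫ x in ucell, kconv A B ω x x) P := by
  have hf := full_int (P := P) hA hB
  refine hf.integral_prod_left.congr ?_
  filter_upwards [hf.prod_right_ae] with ω hω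
  rw [← setIntegral_congr_set hcell_ae, integral_prod _ hω]
  rfl

lemma tpv_conv_int2 (hA : GoodKer θ A) (hB : GoodKer θ B) :
    ∀ᵐ ω ∂P, IntegrableOn (fun x => kconv A B ω x x) ucell := by
  have hf := full_int (P := P) hA hB
  filter_upwards [hf.prod_right_ae] with ω hω
  have := hω.integral_prod_left
  exact (integrableOn_congr_set_ae hcell_ae).1 this

lemma tpv_add {A' B' : Ker} (hA : GoodKer θ A) (hB : GoodKer θ B)
    (hA' : GoodKer θ A') (hB' : GoodKer θ B') :
    tpv P (kconv A B + kconv A' B') = tpv P (kconv A B) + tpv P (kconv A' B') := by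
  unfold tpv
  rw [← integral_add (tpv_conv_int hA hB) (tpv_conv_int hA' hB')]
  refine integral_congr_ae ?_
  filter_upwards [tpv_conv_int2 (P := P) hA hB, tpv_conv_int2 (P := P) hA' hB'] with ω h1 h2
  simp only [Pi.add_apply]
  exact integral_add h1 h2

lemma tpv_comm (hmp : ∀ γ, MeasurePreserving (disorderShift γ) P P)
    (hA : GoodKer θ A) (hB : GoodKer θ B) :
    tpv P (kconv A B) = tpv P (kconv B A) := by
  rw [tpv_conv hA hB, tpv_conv hB hA, cell_swap]
  · simp only [Prod.fst_swap, Prod.snd_swap, mul_comm]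
  · intro γ p
    have hm : AEStronglyMeasurable (fun ω => A ω (diagHom γ + p).1 (diagHom γ + p).2 *
        B ω (diagHom γ + p).2 (diagHom γ + p).1) (P.map (disorderShift γ)) :=
      ((hA.meas_comp (by fun_prop) (by fun_prop) (by fun_prop)).mul
        (hB.meas_comp (by fun_prop) (by fun_prop) (by fun_prop))).aestronglyMeasurable
    have := integral_map (hmp γ).measurable.aemeasurable hm
    rw [(hmp γ).map_eq] at this
    rw [this]
    congr 1
    funext ω
    rw [hA.cov, hB.cov]
    have h1 : (diagHom γ + p).1 - latR2 γ = p.1 := by simp [diagHom_apply]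
    have h2 : (diagHom γ + p).2 - latR2 γ = p.2 := by simp [diagHom_apply]
    rw [h1, h2, mul_mul_mul_comm, ← Complex.exp_add]
    ring_nf
    simp

end trace

/-- iterated kernels as a family -/
def kiter (h : Ker) (M : ℕ) : Ker := fun ω => iterKernel (h ω) M

lemma kiter_succ (h : Ker) (M : ℕ) : kiter h (M + 1) = kconv h (kiter h M) := rfl

lemma good_iter {θ : ℤ × ℤ → (ℝ × ℝ) → ℝ} {h : Ker} (hh : GoodKer θ h) (M : ℕ) :
    GoodKer θ (kiter h M) := by
  induction M with
  | zero => exact hh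
  | succ M ih => exact good_conv hh ih

lemma kiter_conv {θ : ℤ × ℤ → (ℝ × ℝ) → ℝ} {h : Ker} (hh : GoodKer θ h) (a b : ℕ) :
    kconv (kiter h a) (kiter h b) = kiter h (a + b + 1) := by
  induction a with
  | zero => rw [zero_add, kiter_succ]; rfl
  | succ a ih =>
    rw [kiter_succ, kconv_assoc hh (good_iter hh a) (good_iter hh b), ih, ← kiter_succ]
    congr 1; ring

lemma trace_step {P : Measure DisorderSpace} [IsProbabilityMeasure P]
    {θ : ℤ × ℤ → (ℝ × ℝ) → ℝ} {h : Ker}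
    (hmp : ∀ γ, MeasurePreserving (disorderShift γ) P P) (hh : GoodKer θ h)
    {coord : (ℝ × ℝ) → ℝ} (hc : IsCoord coord) (a b : ℕ) :
    tpv P (kconv (kder coord (kiter h a)) (kiter h b))
      = (a + 1) * tpv P (kconv (kder coord h) (kiter h (a + b))) := by
  induction a generalizing b with
  | zero => simp [show kiter h 0 = h from rfl]
  | succ a ih =>
    have ga := good_iter hh a
    have gb := good_iter hh b
    have gd := good_der hh hc
    have gda := good_der ga hc
    rw [kiter_succ, kder_conv hh ga hc, kconv_add_left (good_conv gd ga) (good_conv hh gda) gb,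
      kconv_assoc gd ga gb, kconv_assoc hh gda gb,
      tpv_add gd (good_conv ga gb) hh (good_conv gda gb),
      tpv_comm hmp hh (good_conv gda gb), kconv_assoc gda gb hh, kiter_conv hh,
      show kconv (kiter h b) h = kiter h (b + 0 + 1) from kiter_conv hh b 0, ih]
    rw [show a + (b + 0 + 1) = a + b + 1 by ring, show a + 1 + b = a + b + 1 by ring]
    push_cast
    ring

lemma trace_anti {P : Measure DisorderSpace} [IsProbabilityMeasure P]
    {θ : ℤ × ℤ → (ℝ × ℝ) → ℝ} {A B : Ker}
    (hmp : ∀ γ, MeasurePreserving (disorderShift γ) P P) (hA : GoodKer θ A) (hB : GoodKer θ B)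
    {coord : (ℝ × ℝ) → ℝ} (hc : IsCoord coord) :
    tpv P (kconv (kder coord A) B) = - tpv P (kconv (kder coord B) A) := by
  rw [tpv_comm hmp (good_der hB hc) hA]
  unfold tpv kconv kder
  simp_rw [← integral_neg]
  congr 1; funext ω; congr 1; funext x; congr 1; funext y
  ring

/-- **Vanishing of the equilibrium current (kernel form).**
For a disorder-covariant (up to magnetic phases) family of exponentially localized
continuous kernels `h_ω`, the averaged trace per unit cell of the kernel of
`i[𝔥, X_i] 𝔥^M` vanishes:
`𝔼 ∫_{[0,1]²} dx ∫_{ℝ²} dy h_ω(x,y) (y_i − x_i) h_ω^{(M)}(y,x) = 0` for every `M ≥ 1`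
and `i ∈ {1,2}`. -/
theorem equilibrium_current_vanishes_kernel
    (μ0 : Measure (Set.Icc (-1 : ℝ) 1)) [IsProbabilityMeasure μ0]
    (P : Measure DisorderSpace) [IsProbabilityMeasure P]
    -- `P` is the product measure `⊗_{ℤ²} μ0`, characterized by its cylinder probabilities:
    (hP : ∀ (s : Finset (ℤ × ℤ)) (A : (ℤ × ℤ) → Set (Set.Icc (-1 : ℝ) 1)),
      (∀ i ∈ s, MeasurableSet (A i)) →
        P {ω | ∀ i ∈ s, ω i ∈ A i} = ∏ i ∈ s, μ0 (A i))
    (h : DisorderSpace → (ℝ × ℝ) → (ℝ × ℝ) → ℂ)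
    (hmeas : Measurable (fun p : DisorderSpace × (ℝ × ℝ) × (ℝ × ℝ) => h p.1 p.2.1 p.2.2))
    (hcont : ∀ ω, Continuous (fun p : (ℝ × ℝ) × (ℝ × ℝ) => h ω p.1 p.2))
    (C δ : ℝ) (hC : 0 < C) (hδ : 0 < δ)
    (hbound : ∀ ω, ∀ x y : ℝ × ℝ,
      ‖h ω x y‖ ≤ C * Real.exp (-δ * eNorm2 (x - y)))
    -- magnetic covariance:
    (hcov : ∀ γ : ℤ × ℤ, ∃ θ : (ℝ × ℝ) → ℝ, Measurable θ ∧
      ∀ ω, ∀ x y : ℝ × ℝ,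
        h (disorderShift γ ω) x y
          = Complex.exp (Complex.I * (θ x - θ y)) * h ω (x - latR2 γ) (y - latR2 γ)) :
    ∀ M : ℕ, ∀ coord : (ℝ × ℝ) → ℝ, (coord = Prod.fst ∨ coord = Prod.snd) →
      (∫ ω, (∫ x in (Set.Icc (0:ℝ) 1 ×ˢ Set.Icc (0:ℝ) 1),
        ∫ y : ℝ × ℝ,
          h ω x y * ((coord y - coord x) : ℂ) * iterKernel (h ω) M y x) ∂P) = 0 := by
  intro M coord hc
  choose θ hθ using hcov
  have hh : GoodKer θ h :=
    { meas := hmeas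
      bound := by
        refine ⟨C, δ, hC.le, hδ, fun ω x y => (hbound ω x y).trans ?_⟩
        unfold expProf
        have h1 : ‖x - y‖ ≤ eNorm2 (x - y) := by
          unfold eNorm2
          rw [Prod.norm_def]
          refine max_le ?_ ?_
          · rw [Real.norm_eq_abs]
            exact Real.abs_le_sqrt (by nlinarith [sq_nonneg (x - y).2])
          · rw [Real.norm_eq_abs]
            exact Real.abs_le_sqrt (by nlinarith [sq_nonneg (x - y).1])
        gcongr ?_ * Real.exp ?_
        nlinarith
      cov := fun γ ω x y => (hθ γ).2 ω x y }
  have hmp := shift_mp μ0 P hP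
  have h1 := trace_anti hmp hh (good_iter hh M) hc
  have h2 := trace_step hmp hh hc M 0
  rw [show kiter h 0 = h from rfl] at h2
  rw [h2, add_zero] at h1
  have h3 : ((M : ℂ) + 2) * tpv P (kconv (kder coord h) (kiter h M)) = 0 := by
    linear_combination h1
  have h4 : ((M : ℂ) + 2) ≠ 0 := by exact_mod_cast (by omega : M + 2 ≠ 0)
  exact (mul_eq_zero.1 h3).resolve_left h4

end
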